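/- Let E, F be real Banach spaces, Ω, Ω' ⊆ ℝ^p nonempty open sets, n ≥ 1, and let T : C^n(Ω, E) → C^n(Ω', F) be an ℝ-linear map that is continuous when both spaces carry their standard Fréchet topologies. For e ∈ E let ê ∈ C^n(Ω, E) denote the constant function with value e. Then: (1) for every y ∈ Ω' and every multi-index λ with |λ| ≤ n, the linear map J_λ y : e ↦ ∂^λ(T ê)(y) from E to F is bounded; (2) for |λ| ≤ n−1 the map J_λ : Ω' → L(E, F) is continuous for the operator norm; (3) the map J := J_0 is of class C^{n−1} with ∂^λ J = J_λ for every |λ| ≤ n−1; and (4) J is of class s-C^n, with the strong partial derivatives of its (n−1)-st order partial derivatives given by ∂_s/∂x_i (J_λ) = J_μ, where μ is obtained from λ (|λ| = n−1) by increasing its i-th entry by 1. -/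

import Mathlib

open Set Filter Topology

/-- The partial derivative of `f` with respect to the `i`-th coordinate. -/
noncomputable def partialD {p : ℕ} {E : Type*} [NormedAddCommGroup E] [NormedSpace ℝ E]
    (i : Fin p) (f : (Fin p → ℝ) → E) : (Fin p → ℝ) → E :=
  fun x => fderiv ℝ f x (Pi.single i 1)

/-- The iterated partial derivative `∂^λ f` associated with a multi-index `λ`. -/
noncomputable def pdMulti {p : ℕ} {E : Type*} [NormedAddCommGroup E] [NormedSpace ℝ E]
    (lam : Fin p → ℕ) (f : (Fin p → ℝ) → E) : (Fin p → ℝ) → E :=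
  (List.finRange p).foldr (fun i g => (partialD i)^[lam i] g) f

/-- A map `K : Ω' → L(E, F)` is of class `s-C¹`. -/
def IsSC1 {p : ℕ} {E F : Type*} [NormedAddCommGroup E] [NormedSpace ℝ E]
    [NormedAddCommGroup F] [NormedSpace ℝ F]
    (Ω' : Set (Fin p → ℝ)) (K : (Fin p → ℝ) → (E →L[ℝ] F)) : Prop :=
  ContinuousOn K Ω' ∧
  ∃ K' : Fin p → (Fin p → ℝ) → (E →L[ℝ] F),
    (∀ (i : Fin p) (e : E), ∀ y ∈ Ω',
      HasLineDerivAt ℝ (fun z => K z e) (K' i y e) y (Pi.single i 1)) ∧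
    (∀ (i : Fin p) (e : E), ContinuousOn (fun y => K' i y e) Ω')

/-- `J : Ω' → L(E, F)` is of class `s-Cⁿ`. -/
def IsSCn {p : ℕ} {E F : Type*} [NormedAddCommGroup E] [NormedSpace ℝ E]
    [NormedAddCommGroup F] [NormedSpace ℝ F]
    (n : ℕ) (Ω' : Set (Fin p → ℝ)) (J : (Fin p → ℝ) → (E →L[ℝ] F)) : Prop :=
  ContDiffOn ℝ (n - 1 : ℕ) J Ω' ∧
  ∀ lam : Fin p → ℕ, (∑ i, lam i) = n - 1 → IsSC1 Ω' (pdMulti lam J)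

/-- The space `C^n(Ω, E)`, as a submodule of the functions `ℝ^p → E`. -/
def Cspace (p n : ℕ) (Ω : Set (Fin p → ℝ)) (E : Type*) [NormedAddCommGroup E]
    [NormedSpace ℝ E] : Submodule ℝ ((Fin p → ℝ) → E) where
  carrier := {f | ContDiffOn ℝ n f Ω}
  add_mem' hf hg := hf.add hg
  zero_mem' := contDiffOn_const
  smul_mem' c f hf := hf.const_smul c

/-- The seminorm `p_K(f) = max_{|λ| ≤ n} max_{x ∈ K} ‖∂^λ f(x)‖` of the standard Fréchet
topology of `C^n`. -/
noncomputable def pSemi {p : ℕ} {E : Type*} [NormedAddCommGroup E] [NormedSpace ℝ E]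
    (n : ℕ) (K : Set (Fin p → ℝ)) (f : (Fin p → ℝ) → E) : ℝ :=
  ⨆ lam : Fin p → ℕ, ⨆ _ : (∑ i, lam i) ≤ n, ⨆ x : K, ‖pdMulti lam f ↑x‖

section Words

variable {p : ℕ} {E : Type*} [NormedAddCommGroup E] [NormedSpace ℝ E]

/-- The iterated partial derivative along the letters of a word, the head being applied last. -/
noncomputable def pdWord (w : List (Fin p)) (f : (Fin p → ℝ) → E) : (Fin p → ℝ) → E :=
  w.foldr partialD f

/-- The sorted word in which the letter `i` occurs `lam i` times. -/
def wordOf (lam : Fin p → ℕ) : List (Fin p) :=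
  (List.finRange p).flatMap fun i => List.replicate (lam i) i

/-- The multi-index `lam` with its `i`-th entry increased by one. -/
def bump (lam : Fin p → ℕ) (i : Fin p) : Fin p → ℕ :=
  Function.update lam i (lam i + 1)

@[simp]
theorem pdWord_nil (f : (Fin p → ℝ) → E) : pdWord [] f = f := rfl

@[simp]
theorem pdWord_cons (i : Fin p) (w : List (Fin p)) (f : (Fin p → ℝ) → E) :
    pdWord (i :: w) f = partialD i (pdWord w f) := rfl

theorem foldr_replicate_partialD (i : Fin p) (k : ℕ) (g : (Fin p → ℝ) → E) :
    (List.replicate k i).foldr partialD g = (partialD i)^[k] g := by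
  induction k with
  | zero => rfl
  | succ k ih => rw [List.replicate_succ, List.foldr_cons, ih, Function.iterate_succ_apply']

theorem pdMulti_eq_pdWord (lam : Fin p → ℕ) (f : (Fin p → ℝ) → E) :
    pdMulti lam f = pdWord (wordOf lam) f := by
  unfold pdMulti pdWord wordOf
  induction List.finRange p with
  | nil => rfl
  | cons i l ih =>
    rw [List.foldr_cons, List.flatMap_cons, List.foldr_append, ← ih, foldr_replicate_partialD]

theorem count_wordOf (lam : Fin p → ℕ) (i : Fin p) : (wordOf lam).count i = lam i := by
  rw [wordOf, List.count_flatMap, ← Fin.sum_univ_def]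
  simp [List.count_replicate]

theorem length_wordOf (lam : Fin p → ℕ) : (wordOf lam).length = ∑ i, lam i := by
  rw [wordOf, List.length_flatMap, Fin.sum_univ_def]
  simp

theorem sum_bump (lam : Fin p → ℕ) (i : Fin p) : ∑ j, bump lam i j = (∑ j, lam j) + 1 := by
  rw [bump, Finset.sum_update_of_mem (Finset.mem_univ i),
    ← Finset.add_sum_erase _ lam (Finset.mem_univ i), Finset.sdiff_singleton_eq_erase]
  ring

theorem cons_wordOf_perm (lam : Fin p → ℕ) (i : Fin p) :
    (i :: wordOf lam).Perm (wordOf (bump lam i)) := by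
  rw [List.perm_iff_count]
  intro j
  rw [List.count_cons, count_wordOf, count_wordOf, bump, Function.update_apply]
  by_cases h : j = i
  · subst h; simp
  · simp [h, Ne.symm h]

theorem wordOf_count_perm (w : List (Fin p)) : (wordOf fun i => w.count i).Perm w :=
  List.perm_iff_count.2 fun _ => count_wordOf _ _

variable {s : Set (Fin p → ℝ)} {f g : (Fin p → ℝ) → E}

theorem partialD_eqOn (hs : IsOpen s) (h : EqOn f g s) (i : Fin p) :
    EqOn (partialD i f) (partialD i g) s := fun x hx => by
  rw [partialD, partialD, (h.eventuallyEq_of_mem (hs.mem_nhds hx)).fderiv_eq]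

theorem contDiffOn_partialD (hs : IsOpen s) {m : ℕ} (hf : ContDiffOn ℝ (m + 1 : ℕ) f s)
    (i : Fin p) : ContDiffOn ℝ m (partialD i f) s := by
  have h : ContDiffOn ℝ m (fderiv ℝ f) s := hf.fderiv_of_isOpen hs (by norm_cast)
  exact h.clm_apply contDiffOn_const

theorem contDiffOn_pdWord (hs : IsOpen s) {w : List (Fin p)} {m : ℕ}
    (hf : ContDiffOn ℝ (w.length + m : ℕ) f s) : ContDiffOn ℝ m (pdWord w f) s := by
  induction w generalizing m with
  | nil => simpa using hf
  | cons i w ih =>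
    refine contDiffOn_partialD hs (ih ?_) i
    rwa [List.length_cons, add_assoc, add_comm 1 m] at hf

theorem partialD_comm (hs : IsOpen s) (hf : ContDiffOn ℝ 2 f s) (i j : Fin p) :
    EqOn (partialD i (partialD j f)) (partialD j (partialD i f)) s := fun x hx => by
  have hfx : ContDiffAt ℝ 2 f x := hf.contDiffAt (hs.mem_nhds hx)
  have hd : DifferentiableAt ℝ (fderiv ℝ f) x :=
    (hfx.fderiv_right (m := 1) (by norm_num)).differentiableAt (by norm_num)
  have key (k l : Fin p) : partialD k (partialD l f) x =
      fderiv ℝ (fderiv ℝ f) x (Pi.single k 1) (Pi.single l 1) := by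
    have := hd.hasFDerivAt.clm_apply (hasFDerivAt_const (Pi.single l (1 : ℝ)) x)
    rw [partialD, show partialD l f = fun y => fderiv ℝ f y (Pi.single l 1) from rfl, this.fderiv]
    simp
  rw [key, key]
  exact hfx.isSymmSndFDerivAt (by simp) _ _

theorem pdWord_perm (hs : IsOpen s) {v w : List (Fin p)} (h : v.Perm w)
    (hf : ContDiffOn ℝ v.length f s) : EqOn (pdWord v f) (pdWord w f) s := by
  induction h with
  | nil => exact fun _ _ => rfl
  | cons i _ ih =>
    exact partialD_eqOn hs (ih (hf.of_le (by simp))) i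
  | swap i j l =>
    exact partialD_comm hs (contDiffOn_pdWord (m := 2) hs hf) _ _
  | trans h₁ _ ih₁ ih₂ => exact (ih₁ hf).trans (ih₂ (h₁.length_eq ▸ hf))

theorem differentiableAt_pdWord (hs : IsOpen s) {w : List (Fin p)}
    (hf : ContDiffOn ℝ (w.length + 1 : ℕ) f s) {x : Fin p → ℝ} (hx : x ∈ s) :
    DifferentiableAt ℝ (pdWord w f) x :=
  ((contDiffOn_pdWord (m := 1) hs hf).contDiffAt (hs.mem_nhds hx)).differentiableAt (by simp)

theorem pdWord_add (hs : IsOpen s) {w : List (Fin p)} (hf : ContDiffOn ℝ w.length f s)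
    (hg : ContDiffOn ℝ w.length g s) :
    EqOn (pdWord w (f + g)) (pdWord w f + pdWord w g) s := by
  induction w with
  | nil => exact fun _ _ => rfl
  | cons i w ih =>
    intro x hx
    rw [pdWord_cons, partialD_eqOn hs (ih (hf.of_le (by simp)) (hg.of_le (by simp))) i hx,
      partialD, fderiv_add (differentiableAt_pdWord hs hf hx) (differentiableAt_pdWord hs hg hx)]
    rfl

theorem pdWord_const_smul (hs : IsOpen s) (c : ℝ) {w : List (Fin p)}
    (hf : ContDiffOn ℝ w.length f s) : EqOn (pdWord w (c • f)) (c • pdWord w f) s := by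
  induction w with
  | nil => exact fun _ _ => rfl
  | cons i w ih =>
    intro x hx
    rw [pdWord_cons, partialD_eqOn hs (ih (hf.of_le (by simp))) i hx,
      partialD, fderiv_const_smul (differentiableAt_pdWord hs hf hx)]
    rfl

theorem norm_pdWord_const_le (w : List (Fin p)) (e : E) (x : Fin p → ℝ) :
    ‖pdWord w (fun _ => e) x‖ ≤ ‖e‖ := by
  suffices h : ∃ c : E, ‖c‖ ≤ ‖e‖ ∧ pdWord w (fun _ => e) = fun _ => c by
    obtain ⟨c, hc, h⟩ := h
    rwa [h]
  induction w with
  | nil => exact ⟨e, le_rfl, rfl⟩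
  | cons i w ih =>
    obtain ⟨c, -, h⟩ := ih
    refine ⟨0, by simp, ?_⟩
    rw [pdWord_cons, h]
    ext y
    simp [partialD]

theorem contDiffOn_pdMulti (hs : IsOpen s) {lam : Fin p → ℕ} {m n : ℕ}
    (hf : ContDiffOn ℝ n f s) (h : (∑ i, lam i) + m ≤ n) : ContDiffOn ℝ m (pdMulti lam f) s := by
  rw [pdMulti_eq_pdWord]
  refine contDiffOn_pdWord hs (hf.of_le ?_)
  rw [length_wordOf]
  exact_mod_cast h

theorem partialD_pdMulti (hs : IsOpen s) {lam : Fin p → ℕ} {n : ℕ}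
    (hf : ContDiffOn ℝ n f s) (h : (∑ i, lam i) + 1 ≤ n) (i : Fin p) :
    EqOn (partialD i (pdMulti lam f)) (pdMulti (bump lam i) f) s := by
  rw [pdMulti_eq_pdWord, pdMulti_eq_pdWord, ← pdWord_cons]
  refine pdWord_perm hs (cons_wordOf_perm lam i) (hf.of_le ?_)
  rw [List.length_cons, length_wordOf]
  exact_mod_cast h

theorem hasFDerivAt_of_partialD {x : Fin p → ℝ} (hf : DifferentiableAt ℝ f x) :
    HasFDerivAt f (∑ i, (ContinuousLinearMap.proj (R := ℝ) (φ := fun _ : Fin p => ℝ) i).smulRight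
      (partialD i f x)) x := by
  suffices h : ∑ i, (ContinuousLinearMap.proj (R := ℝ) (φ := fun _ : Fin p => ℝ) i).smulRight
      (partialD i f x) = fderiv ℝ f x from h ▸ hf.hasFDerivAt
  ext v
  have hv : v = ∑ i, v i • Pi.single i (1 : ℝ) := by
    ext j
    simp [Pi.single_apply]
  conv_rhs => rw [hv, map_sum]
  simp [partialD]

end Words

section Seminorm

variable {p : ℕ} {E : Type*} [NormedAddCommGroup E] [NormedSpace ℝ E]

theorem finite_multiIndex (p n : ℕ) : {lam : Fin p → ℕ | ∑ i, lam i ≤ n}.Finite :=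
  (Set.finite_Iic fun _ : Fin p => n).subset fun _ h i =>
    (Finset.single_le_sum (fun _ _ => Nat.zero_le _) (Finset.mem_univ i)).trans h

theorem norm_pdMulti_le_pSemi {n : ℕ} {s K : Set (Fin p → ℝ)} {f : (Fin p → ℝ) → E}
    (hs : IsOpen s) (hf : ContDiffOn ℝ n f s) (hK : IsCompact K) (hKs : K ⊆ s)
    {lam : Fin p → ℕ} (hlam : ∑ i, lam i ≤ n) {x : Fin p → ℝ} (hx : x ∈ K) :
    ‖pdMulti lam f x‖ ≤ pSemi n K f := by
  have h₁ : BddAbove (range fun x : K => ‖pdMulti lam f ↑x‖) := by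
    have hc : ContinuousOn (fun x => ‖pdMulti lam f x‖) K :=
      ((contDiffOn_pdMulti (m := 0) hs hf hlam).continuousOn.mono hKs).norm
    have := hK.bddAbove_image hc
    rwa [image_eq_range] at this
  have h₂ : BddAbove (range fun lam : Fin p → ℕ =>
      ⨆ _ : (∑ i, lam i) ≤ n, ⨆ x : K, ‖pdMulti lam f ↑x‖) := by
    refine (((finite_multiIndex p n).image fun lam : Fin p → ℕ =>
      ⨆ _ : (∑ i, lam i) ≤ n, ⨆ x : K, ‖pdMulti lam f ↑x‖).insert 0).bddAbove.mono
        (range_subset_iff.2 fun mu => ?_)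
    by_cases hmu : ∑ i, mu i ≤ n
    · exact mem_insert_of_mem _ (mem_image_of_mem _ hmu)
    · exact mem_insert_iff.2 (.inl (by simp [hmu]))
  calc ‖pdMulti lam f x‖ ≤ ⨆ x : K, ‖pdMulti lam f ↑x‖ := le_ciSup h₁ ⟨x, hx⟩
    _ = ⨆ _ : (∑ i, lam i) ≤ n, ⨆ x : K, ‖pdMulti lam f ↑x‖ := by simp [hlam]
    _ ≤ pSemi n K f := le_ciSup h₂ lam

theorem pSemi_const_le (n : ℕ) (K : Set (Fin p → ℝ)) (e : E) :
    pSemi n K (fun _ => e) ≤ ‖e‖ := by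
  refine Real.iSup_le (fun lam => Real.iSup_le (fun _ => Real.iSup_le (fun x => ?_)
    (norm_nonneg e)) (norm_nonneg e)) (norm_nonneg e)
  rw [pdMulti_eq_pdWord]
  exact norm_pdWord_const_le _ _ _

end Seminorm

section StrongDerivative

variable {V E F : Type*} [NormedAddCommGroup V] [NormedSpace ℝ V] [NormedAddCommGroup E]
  [NormedSpace ℝ E] [NormedAddCommGroup F] [NormedSpace ℝ F]
  {s : Set V} {A : V → E →L[ℝ] F} {A' : V → V →L[ℝ] E →L[ℝ] F}

theorem continuousAt_of_hasFDerivAt_apply (hs : IsOpen s)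
    (h : ∀ y ∈ s, ∀ e, HasFDerivAt (fun z => A z e) ((A' y).flip e) y) {y : V} (hy : y ∈ s)
    {M : ℝ} (hM : ∀ᶠ z in 𝓝 y, ‖A' z‖ ≤ M) : ContinuousAt A y := by
  obtain ⟨r, hr, hball⟩ := Metric.eventually_nhds_iff_ball.1 (hM.and (hs.mem_nhds hy))
  have hM0 : 0 ≤ M := (norm_nonneg (A' y)).trans (hball y (Metric.mem_ball_self hr)).1
  have hlip : ∀ z ∈ Metric.ball y r, ‖A z - A y‖ ≤ M * ‖z - y‖ := fun z hz => by
    refine ContinuousLinearMap.opNorm_le_bound _ (by positivity) fun e => ?_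
    have := (convex_ball y r).norm_image_sub_le_of_norm_hasFDerivWithin_le (C := M * ‖e‖)
      (fun x hx => (h x (hball x hx).2 e).hasFDerivWithinAt)
      (fun x hx => ((A' x).flip.le_opNorm e).trans ?_) (Metric.mem_ball_self hr) hz
    · simpa [mul_right_comm] using this
    · rw [ContinuousLinearMap.opNorm_flip]
      gcongr
      exact (hball x hx).1
  rw [ContinuousAt, tendsto_iff_norm_sub_tendsto_zero]
  refine squeeze_zero' (.of_forall fun _ => norm_nonneg _)
    (eventually_of_mem (Metric.ball_mem_nhds y hr) hlip) ?_
  have : ContinuousAt (fun z => M * ‖z - y‖) y := by fun_prop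
  simpa [ContinuousAt] using this

theorem hasFDerivAt_of_hasFDerivAt_apply (hs : IsOpen s)
    (h : ∀ y ∈ s, ∀ e, HasFDerivAt (fun z => A z e) ((A' y).flip e) y) {y : V} (hy : y ∈ s)
    (hA' : ContinuousAt A' y) : HasFDerivAt A (A' y) y := by
  rw [hasFDerivAt_iff_isLittleO, Asymptotics.isLittleO_iff]
  intro c hc
  have hclose : ∀ᶠ z in 𝓝 y, ‖A' z - A' y‖ ≤ c := by
    have hnorm : ContinuousAt (fun z => ‖A' z - A' y‖) y :=
      (continuous_norm (E := V →L[ℝ] E →L[ℝ] F)).continuousAt.comp (hA'.sub continuousAt_const)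
    refine hnorm.tendsto.eventually_le_const ?_
    rwa [sub_self, ContinuousLinearMap.opNorm_zero]
  obtain ⟨r, hr, hball⟩ := Metric.eventually_nhds_iff_ball.1 (hclose.and (hs.mem_nhds hy))
  have hflip (x : V) (e : E) : (A' x).flip e - (A' y).flip e = (A' x - A' y).flip e := by
    ext
    simp
  have hbound : ∀ e, ∀ x ∈ Metric.ball y r, ‖(A' x).flip e - (A' y).flip e‖ ≤ c * ‖e‖ := by
    intro e x hx
    rw [hflip]
    refine ((A' x - A' y).flip.le_opNorm e).trans ?_
    rw [ContinuousLinearMap.opNorm_flip]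
    exact mul_le_mul_of_nonneg_right (hball x hx).1 (norm_nonneg e)
  filter_upwards [Metric.ball_mem_nhds y hr] with z hz
  have h0 : 0 ≤ c * ‖z - y‖ := by positivity
  refine ContinuousLinearMap.opNorm_le_bound (A z - A y - A' y (z - y)) h0 fun e => ?_
  have := (convex_ball y r).norm_image_sub_le_of_norm_hasFDerivWithin_le'
    (f := fun z => A z e) (f' := fun x => (A' x).flip e) (φ := (A' y).flip e)
    (fun x hx => (h x (hball x hx).2 e).hasFDerivWithinAt) (hbound e)
    (Metric.mem_ball_self hr) hz
  simpa [mul_right_comm] using this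

end StrongDerivative

section Gradient

variable {p : ℕ} {E F : Type*} [NormedAddCommGroup E] [NormedSpace ℝ E] [NormedAddCommGroup F]
  [NormedSpace ℝ F]

/-- The linear map `v ↦ ∑ i, v i • a i` with values in `L(E, F)`. -/
noncomputable def gradOp (a : Fin p → E →L[ℝ] F) : (Fin p → ℝ) →L[ℝ] E →L[ℝ] F :=
  ∑ i, (ContinuousLinearMap.proj (R := ℝ) (φ := fun _ : Fin p => ℝ) i).smulRight (a i)

theorem gradOp_single (a : Fin p → E →L[ℝ] F) (i : Fin p) : gradOp a (Pi.single i 1) = a i := by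
  simp [gradOp, Pi.single_apply]

theorem gradOp_flip (a : Fin p → E →L[ℝ] F) (e : E) : (gradOp a).flip e =
    ∑ i, (ContinuousLinearMap.proj (R := ℝ) (φ := fun _ : Fin p => ℝ) i).smulRight (a i e) := by
  ext i
  simp [gradOp]

theorem norm_gradOp_le {a : Fin p → E →L[ℝ] F} {M : ℝ} (h : ∀ i, ‖a i‖ ≤ M) :
    ‖gradOp a‖ ≤ p * M := by
  refine (norm_sum_le_of_le Finset.univ (f := fun i => (ContinuousLinearMap.proj (R := ℝ)
    (φ := fun _ : Fin p => ℝ) i).smulRight (a i)) (n := fun _ => M) fun i _ => ?_).trans (by simp)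
  have hM : 0 ≤ M := (norm_nonneg _).trans (h i)
  refine ContinuousLinearMap.opNorm_le_bound _ hM fun v => ?_
  rw [ContinuousLinearMap.smulRight_apply, norm_smul, mul_comm M]
  exact mul_le_mul (norm_le_pi_norm v i) (h i) (norm_nonneg _) (norm_nonneg _)

theorem contDiffOn_gradOp {s : Set (Fin p → ℝ)} {m : ℕ} {a : Fin p → (Fin p → ℝ) → E →L[ℝ] F}
    (h : ∀ i, ContDiffOn ℝ m (a i) s) : ContDiffOn ℝ m (fun y => gradOp fun i => a i y) s :=
  ContDiffOn.sum fun i _ => contDiffOn_const.smulRight (h i)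

variable {s : Set (Fin p → ℝ)} {n : ℕ} {J : (Fin p → ℕ) → (Fin p → ℝ) → E →L[ℝ] F}

theorem contDiffOn_of_hasFDerivAt_gradOp (hs : IsOpen s)
    (hc : ∀ lam, ∑ i, lam i ≤ n → ContinuousOn (J lam) s)
    (hd : ∀ lam, ∑ i, lam i + 1 ≤ n → ∀ y ∈ s,
      HasFDerivAt (J lam) (gradOp fun i => J (bump lam i) y) y)
    {m : ℕ} {lam : Fin p → ℕ} (h : ∑ i, lam i + m ≤ n) : ContDiffOn ℝ m (J lam) s := by
  induction m generalizing lam with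
  | zero => exact contDiffOn_zero.2 (hc lam h)
  | succ m ih =>
    have hd' := hd lam (by lia)
    push_cast
    rw [contDiffOn_succ_iff_fderiv_of_isOpen hs]
    refine ⟨fun y hy => (hd' y hy).differentiableAt.differentiableWithinAt, by simp, ?_⟩
    refine (contDiffOn_gradOp fun i => ih (lam := bump lam i) ?_).congr
      fun y hy => (hd' y hy).fderiv
    rw [sum_bump]
    lia

theorem pdMulti_eq_of_hasFDerivAt_gradOp (hs : IsOpen s)
    (hd : ∀ lam, ∑ i, lam i + 1 ≤ n → ∀ y ∈ s,
      HasFDerivAt (J lam) (gradOp fun i => J (bump lam i) y) y)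
    {lam : Fin p → ℕ} (h : ∑ i, lam i ≤ n) : EqOn (pdMulti lam (J 0)) (J lam) s := by
  have key (w : List (Fin p)) (hw : w.length ≤ n) :
      EqOn (pdWord w (J 0)) (J fun i => w.count i) s := by
    induction w with
    | nil => exact fun _ _ => rfl
    | cons i w ih =>
      intro y hy
      have hsum : ∑ j, w.count j = w.length := by
        rw [← length_wordOf, (wordOf_count_perm w).length_eq]
      rw [List.length_cons] at hw
      have hbump : bump (fun j => w.count j) i = fun j => (i :: w).count j := by
        ext j
        rw [bump, Function.update_apply, List.count_cons]
        by_cases hj : j = i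
        · simp [hj]
        · simp [hj, Ne.symm hj]
      rw [pdWord_cons, partialD_eqOn hs (ih (by lia)) i hy, partialD,
        (hd _ (hsum ▸ hw) y hy).fderiv, gradOp_single, hbump]
  rw [pdMulti_eq_pdWord]
  simpa only [count_wordOf] using key (wordOf lam) ((length_wordOf lam).trans_le h)

end Gradient

/-- for a continuous linear map `T` between the Fréchet spaces `C^n(Ω, E)` and
`C^n(Ω', F)`, the maps `J_λ y : e ↦ ∂^λ(T ê)(y)` are bounded linear operators for `|λ| ≤ n`,
the maps `J_λ : Ω' → L(E,F)` are norm-continuous for `|λ| ≤ n − 1`, `J := J₀` is of class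
`C^{n-1}` with `∂^λ J = J_λ` for `|λ| ≤ n − 1`, and `J` is of class `s-Cⁿ`, the strong partial
derivatives of its `(n-1)`-st order partials being `∂ₛ/∂x_i (J_λ) = J_μ` (`μ = λ + δᵢ`). -/
theorem continuous_linear_weights_structure {p n : ℕ} {E F : Type*}
    [NormedAddCommGroup E] [NormedSpace ℝ E] [CompleteSpace E]
    [NormedAddCommGroup F] [NormedSpace ℝ F] [CompleteSpace F]
    {Ω Ω' : Set (Fin p → ℝ)}
    (hΩ : IsOpen Ω) (hΩne : Ω.Nonempty) (hΩ' : IsOpen Ω') (hΩ'ne : Ω'.Nonempty)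
    (hn : 1 ≤ n)
    (T : Cspace p n Ω E →ₗ[ℝ] Cspace p n Ω' F)
    -- `T` is continuous for the standard Fréchet topologies, expressed through the
    -- defining seminorms
    (hT : ∀ K' ⊆ Ω', IsCompact K' → ∃ K ⊆ Ω, IsCompact K ∧ ∃ C : ℝ, 0 < C ∧
      ∀ f : Cspace p n Ω E, pSemi n K' (T f).1 ≤ C * pSemi n K f.1) :
    ∃ Jc : (Fin p → ℕ) → (Fin p → ℝ) → (E →L[ℝ] F),
      -- (1) for `|λ| ≤ n`, `J_λ y : e ↦ ∂^λ (T ê)(y)` is a bounded linear operator,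
      -- packaged by `Jc`
      (∀ lam : Fin p → ℕ, (∑ i, lam i) ≤ n → ∀ y ∈ Ω', ∀ e : E,
        Jc lam y e = pdMulti lam (T ⟨fun _ => e, contDiffOn_const⟩).1 y) ∧
      -- (2) for `|λ| ≤ n − 1`, `J_λ : Ω' → L(E, F)` is continuous for the operator norm
      (∀ lam : Fin p → ℕ, (∑ i, lam i) ≤ n - 1 → ContinuousOn (Jc lam) Ω') ∧
      -- (3) `J = J₀` is of class `C^{n-1}` and `∂^λ J = J_λ` on `Ω'` for `|λ| ≤ n − 1`
      ContDiffOn ℝ (n - 1 : ℕ) (Jc 0) Ω' ∧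
      (∀ lam : Fin p → ℕ, (∑ i, lam i) ≤ n - 1 → ∀ y ∈ Ω',
        pdMulti lam (Jc 0) y = Jc lam y) ∧
      -- (4) `J` is of class `s-Cⁿ`, with strong partial derivatives `∂ₛ/∂x_i (J_λ) = J_μ`
      IsSCn n Ω' (Jc 0) ∧
      (∀ lam : Fin p → ℕ, (∑ i, lam i) = n - 1 → ∀ (i : Fin p) (e : E), ∀ y ∈ Ω',
        HasLineDerivAt ℝ (fun z => Jc lam z e)
          (Jc (Function.update lam i (lam i + 1)) y e) y (Pi.single i 1)) ∧
      (∀ mu : Fin p → ℕ, (∑ i, mu i) = n → ∀ e : E,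
        ContinuousOn (fun y => Jc mu y e) Ω') := by
  let g : E → (Fin p → ℝ) → F := fun e => (T ⟨fun _ => e, contDiffOn_const⟩).1
  have hg (e : E) : ContDiffOn ℝ n (g e) Ω' := (T ⟨fun _ => e, contDiffOn_const⟩).2
  have hgadd (e e' : E) : g (e + e') = g e + g e' :=
    congrArg Subtype.val (T.map_add ⟨fun _ => e, contDiffOn_const⟩ ⟨fun _ => e', contDiffOn_const⟩)
  have hgsmul (c : ℝ) (e : E) : g (c • e) = c • g e :=
    congrArg Subtype.val (T.map_smul c ⟨fun _ => e, contDiffOn_const⟩)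
  have hbound {K' : Set (Fin p → ℝ)} (hK' : IsCompact K') (hK's : K' ⊆ Ω') :
      ∃ C : ℝ, 0 ≤ C ∧ ∀ lam : Fin p → ℕ, ∑ i, lam i ≤ n → ∀ y ∈ K', ∀ e,
        ‖pdMulti lam (g e) y‖ ≤ C * ‖e‖ := by
    obtain ⟨K, -, -, C, hC, h⟩ := hT K' hK's hK'
    refine ⟨C, hC.le, fun lam hlam y hy e => ?_⟩
    refine (norm_pdMulti_le_pSemi hΩ' (hg e) hK' hK's hlam hy).trans ((h _).trans ?_)
    gcongr
    exact pSemi_const_le n K e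
  have hex (lam : Fin p → ℕ) (y : Fin p → ℝ) : ∃ A : E →L[ℝ] F,
      ∑ i, lam i ≤ n → y ∈ Ω' → ∀ e, A e = pdMulti lam (g e) y := by
    by_cases hlam : ∑ i, lam i ≤ n
    swap; · exact ⟨0, fun h => absurd h hlam⟩
    by_cases hy : y ∈ Ω'
    swap; · exact ⟨0, fun _ h => absurd h hy⟩
    have hg' (e : E) : ContDiffOn ℝ (wordOf lam).length (g e) Ω' :=
      (hg e).of_le (by rw [length_wordOf]; exact_mod_cast hlam)
    obtain ⟨C, -, hC⟩ := hbound (isCompact_singleton (x := y)) (singleton_subset_iff.2 hy)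
    refine ⟨LinearMap.mkContinuous
      { toFun := fun e => pdMulti lam (g e) y
        map_add' := fun e e' => ?_
        map_smul' := fun c e => ?_ } C fun e => hC lam hlam y rfl e, fun _ _ _ => rfl⟩
    · rw [hgadd]
      simp only [pdMulti_eq_pdWord]
      exact pdWord_add hΩ' (hg' e) (hg' e') hy
    · rw [hgsmul]
      simp only [pdMulti_eq_pdWord]
      exact pdWord_const_smul hΩ' c (hg' e) hy
  choose J hJ using hex
  have hJd (lam : Fin p → ℕ) (hlam : ∑ i, lam i + 1 ≤ n) (y : Fin p → ℝ) (hy : y ∈ Ω') (e : E) :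
      HasFDerivAt (fun z => J lam z e) ((gradOp fun i => J (bump lam i) y).flip e) y := by
    have hdiff : DifferentiableAt ℝ (pdMulti lam (g e)) y :=
      ((contDiffOn_pdMulti (m := 1) hΩ' (hg e) hlam).contDiffAt
        (hΩ'.mem_nhds hy)).differentiableAt (by simp)
    have hsum (i : Fin p) : J (bump lam i) y e = partialD i (pdMulti lam (g e)) y := by
      rw [hJ _ _ ((sum_bump lam i).trans_le hlam) hy, partialD_pdMulti hΩ' (hg e) hlam i hy]
    simp only [gradOp_flip, hsum]
    refine (hasFDerivAt_of_partialD hdiff).congr_of_eventuallyEq ?_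
    filter_upwards [hΩ'.mem_nhds hy] with z hz
    exact hJ lam z (by lia) hz e
  have hJcont (lam : Fin p → ℕ) (hlam : ∑ i, lam i ≤ n - 1) : ContinuousOn (J lam) Ω' := by
    intro y hy
    obtain ⟨K', hK', hyK', hK's⟩ := exists_compact_subset hΩ' hy
    obtain ⟨C, hC0, hC⟩ := hbound hK' hK's
    refine (continuousAt_of_hasFDerivAt_apply hΩ' (hJd lam (by lia)) hy
      (M := p * C) ?_).continuousWithinAt
    filter_upwards [mem_interior_iff_mem_nhds.1 hyK'] with z hz
    have hlam' (i : Fin p) : ∑ j, bump lam i j ≤ n := by rw [sum_bump]; lia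
    refine norm_gradOp_le fun i => ContinuousLinearMap.opNorm_le_bound _ hC0 fun e => ?_
    rw [hJ _ _ (hlam' i) (hK's hz)]
    exact hC _ (hlam' i) z hz e
  have hJf (lam : Fin p → ℕ) (hlam : ∑ i, lam i + 1 ≤ n - 1) (y : Fin p → ℝ) (hy : y ∈ Ω') :
      HasFDerivAt (J lam) (gradOp fun i => J (bump lam i) y) y := by
    refine hasFDerivAt_of_hasFDerivAt_apply hΩ' (hJd lam (by lia)) hy ?_
    have hgrad : ContDiffOn ℝ (0 : ℕ) (fun z => gradOp fun i => J (bump lam i) z) Ω' :=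
      contDiffOn_gradOp fun i => contDiffOn_zero.2 (hJcont _ ((sum_bump lam i).trans_le hlam))
    exact hgrad.continuousOn.continuousAt (hΩ'.mem_nhds hy)
  have hJC : ContDiffOn ℝ (n - 1 : ℕ) (J 0) Ω' :=
    contDiffOn_of_hasFDerivAt_gradOp hΩ' hJcont hJf (by simp)
  have hJp (lam : Fin p → ℕ) (hlam : ∑ i, lam i ≤ n - 1) : EqOn (pdMulti lam (J 0)) (J lam) Ω' :=
    pdMulti_eq_of_hasFDerivAt_gradOp hΩ' hJf hlam
  have hJline (lam : Fin p → ℕ) (hlam : ∑ i, lam i = n - 1) (i : Fin p) (e : E)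
      (y : Fin p → ℝ) (hy : y ∈ Ω') :
      HasLineDerivAt ℝ (fun z => J lam z e) (J (bump lam i) y e) y (Pi.single i 1) := by
    have := (hJd lam (by lia) y hy e).hasLineDerivAt (Pi.single i 1)
    rwa [ContinuousLinearMap.flip_apply, gradOp_single] at this
  have hJstrong (mu : Fin p → ℕ) (hmu : ∑ i, mu i = n) (e : E) :
      ContinuousOn (fun y => J mu y e) Ω' :=
    (contDiffOn_pdMulti (m := 0) hΩ' (hg e) hmu.le).continuousOn.congr
      fun y hy => hJ mu y hmu.le hy e
  refine ⟨J, fun lam hlam y hy e => hJ lam y hlam hy e, hJcont, hJC, hJp,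
    ⟨hJC, fun lam hlam => ⟨(hJcont lam hlam.le).congr (hJp lam hlam.le),
      fun i => J (bump lam i), fun i e y hy => ?_, fun i e => hJstrong _ ?_ e⟩⟩, hJline, hJstrong⟩
  · refine (hJline lam hlam i e y hy).congr_of_eventuallyEq ?_
    filter_upwards [hΩ'.mem_nhds hy] with z hz
    rw [hJp lam hlam.le hz]
  · rw [sum_bump]
    lia
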